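/- arXiv:1209.0540 — 2 statements merged into one kernel-verified Lean document; each statement's English description precedes it below -/
import Mathlib

section
/- Let P and Q be exact sequences 0 → M → P_r → ⋯ → P_1 → P_0 → N → 0 and 0 → M → Q_r → ⋯ → Q_1 → Q_0 → N → 0 in an abelian category representing the same class in Ext^{r+1}(N, M), with all P_i and Q_i projective. Then ⊕_{i≥0}(P_{2i} ⊕ Q_{2i+1}) ≅ ⊕_{i≥0}(P_{2i+1} ⊕ Q_{2i}). -/
open CategoryTheory CategoryTheory.Limits CategoryTheory.Abelian

universe w v u

attribute [local instance] CategoryTheory.Abelian.hasFiniteBiproducts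

/-- The Yoneda Ext class of an exact sequence
`0 → K (i+1) → P i → K i → ⋯ → K 1 → P 0 → K 0 = N → 0`, presented as a splice of
short exact sequences `0 → K (j+1) → P j → K j → 0` for `j ≤ r`: it is the Yoneda
composite of the `Ext¹`-classes of these short exact sequences; `spliceClass … i hi`
is the class in `Ext N (K i) i` of the truncated sequence. -/
noncomputable def spliceClass {A : Type u} [Category.{v} A] [Abelian A] [HasExt.{w} A]
    {N : A} {K P : ℕ → A} (r : ℕ) (hK0 : K 0 = N)
    (f : ∀ i, K (i + 1) ⟶ P i) (g : ∀ i, P i ⟶ K i) (wfg : ∀ i, f i ≫ g i = 0)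
    (hse : ∀ i, i ≤ r → (ShortComplex.mk (f i) (g i) (wfg i)).ShortExact) :
    ∀ i : ℕ, i ≤ r + 1 → Ext.{w} N (K i) i
  | 0, _ => Ext.mk₀ (eqToHom hK0.symm)
  | (i + 1), hi =>
      (spliceClass r hK0 f g wfg hse i (le_trans (Nat.le_succ i) hi)).comp
        (hse i (Nat.succ_le_succ_iff.mp hi)).extClass rfl

section SchanuelHelpers

variable {A : Type u} [Category.{v} A] [Abelian A]

/-- Explicit Schanuel isomorphism with prescribed component `K ⟶ L`. -/
lemma schanuel_core {K X L Y Z : A} (f : K ⟶ X) (g : X ⟶ Z) (f' : L ⟶ Y) (g' : Y ⟶ Z)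
    [Mono f] [Mono f'] (wf' : f' ≫ g' = 0)
    (hl : ∀ (T : A) (t : T ⟶ X), t ≫ g = 0 → ∃ s, s ≫ f = t)
    (hl' : ∀ (T : A) (t : T ⟶ Y), t ≫ g' = 0 → ∃ s, s ≫ f' = t)
    (α : X ⟶ Y) (hα : α ≫ g' = g) (β : Y ⟶ X) (hβ : β ≫ g = g')
    (κ : K ⟶ L) (hκ : κ ≫ f' = f ≫ α) :
    ∃ Ψ : K ⊞ Y ≅ L ⊞ X, biprod.inl ≫ Ψ.hom ≫ biprod.fst = κ := by
  obtain ⟨u, hu⟩ := hl X (𝟙 X - α ≫ β) (by simp [hα, hβ])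
  obtain ⟨v, hv⟩ := hl' Y (𝟙 Y - β ≫ α) (by simp [hα, hβ])
  obtain ⟨l, hl2⟩ := hl L (f' ≫ β) (by simp [hβ, wf'])
  refine ⟨⟨biprod.desc (biprod.lift κ f) (biprod.lift (-v) β),
    biprod.desc (biprod.lift l (-f')) (biprod.lift u α), ?_, ?_⟩, by simp⟩
  · ext
    · simp only [← cancel_mono f]
      simp [Preadditive.add_comp, hu, hl2, reassoc_of% hκ]
    · simp [hκ]
    · simp only [← cancel_mono f]
      simp [Preadditive.add_comp, hu, hl2, reassoc_of% hv]
    · simp [hv]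
  · ext
    · simp only [← cancel_mono f']
      simp [Preadditive.add_comp, hκ, hv, reassoc_of% hl2]
    · simp [hl2]
    · simp only [← cancel_mono f']
      simp [Preadditive.add_comp, hκ, hv, reassoc_of% hu]
    · simp [hu]

/-- One step of the iterated Schanuel construction. -/
lemma schanuel_step [HasExt.{w} A] {K' P K L' Q L E O : A}
    (f : K' ⟶ P) (g : P ⟶ K) (wf : f ≫ g = 0) (hs : (ShortComplex.mk f g wf).ShortExact)
    (f' : L' ⟶ Q) (g' : Q ⟶ L) (wf' : f' ≫ g' = 0)
    (hs' : (ShortComplex.mk f' g' wf').ShortExact)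
    [Projective P] [Projective Q] [Projective E] [Projective O]
    (Φ : K ⊞ E ≅ L ⊞ O) :
    ∃ κ : K' ⟶ L',
      hs.extClass.comp (Ext.mk₀ κ) (add_zero 1) =
        (Ext.mk₀ (biprod.inl ≫ Φ.hom ≫ biprod.fst)).comp hs'.extClass (zero_add 1) ∧
      ∀ h : P ⟶ L', ∃ Ψ : K' ⊞ (Q ⊞ O) ≅ L' ⊞ (P ⊞ E),
        biprod.inl ≫ Ψ.hom ≫ biprod.fst = κ - f ≫ h := by
  have : Mono f := hs.mono_f
  have : Mono f' := hs'.mono_f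
  have : Epi g := hs.epi_g
  have : Epi g' := hs'.epi_g
  let α : P ⊞ E ⟶ Q ⊞ O :=
    Projective.factorThru (biprod.map g (𝟙 E) ≫ Φ.hom) (biprod.map g' (𝟙 O))
  have hα : α ≫ biprod.map g' (𝟙 O) = biprod.map g (𝟙 E) ≫ Φ.hom :=
    Projective.factorThru_comp _ _
  let β : Q ⊞ O ⟶ P ⊞ E :=
    Projective.factorThru (biprod.map g' (𝟙 O) ≫ Φ.inv) (biprod.map g (𝟙 E))
  have hβ : β ≫ biprod.map g (𝟙 E) = biprod.map g' (𝟙 O) ≫ Φ.inv :=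
    Projective.factorThru_comp _ _
  have hβ' : β ≫ biprod.map g (𝟙 E) ≫ Φ.hom = biprod.map g' (𝟙 O) := by
    rw [reassoc_of% hβ]; simp
  have lift1 : ∀ (T : A) (t : T ⟶ P), t ≫ g = 0 → ∃ s, s ≫ f = t := fun T t ht =>
    ⟨hs.exact.lift t ht, hs.exact.lift_f t ht⟩
  have lift2 : ∀ (T : A) (t : T ⟶ Q), t ≫ g' = 0 → ∃ s, s ≫ f' = t := fun T t ht =>
    ⟨hs'.exact.lift t ht, hs'.exact.lift_f t ht⟩
  have lift1' : ∀ (T : A) (t : T ⟶ P ⊞ E), t ≫ biprod.map g (𝟙 E) ≫ Φ.hom = 0 →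
      ∃ s, s ≫ f ≫ biprod.inl = t := by
    intro T t ht
    have h0 : t ≫ biprod.map g (𝟙 E) = 0 := by
      rw [← cancel_mono Φ.hom]; simpa using ht
    have h1 := congrArg (· ≫ biprod.fst) h0
    have h2 := congrArg (· ≫ biprod.snd) h0
    simp at h1 h2
    obtain ⟨s, hs⟩ := lift1 T (t ≫ biprod.fst) (by simpa using h1)
    refine ⟨s, ?_⟩
    ext
    · simp [hs]
    · simp [h2]
  have lift2' : ∀ (T : A) (t : T ⟶ Q ⊞ O), t ≫ biprod.map g' (𝟙 O) = 0 →
      ∃ s, s ≫ f' ≫ biprod.inl = t := by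
    intro T t h0
    have h1 := congrArg (· ≫ biprod.fst) h0
    have h2 := congrArg (· ≫ biprod.snd) h0
    simp at h1 h2
    obtain ⟨s, hs⟩ := lift2 T (t ≫ biprod.fst) (by simpa using h1)
    refine ⟨s, ?_⟩
    ext
    · simp [hs]
    · simp [h2]
  obtain ⟨κ, hκ⟩ := lift2' K' (f ≫ biprod.inl ≫ α) (by
    simp only [Category.assoc, hα]; simp [reassoc_of% wf])
  refine ⟨κ, ?_, fun h => ?_⟩
  · let φ : ShortComplex.mk f g wf ⟶ ShortComplex.mk f' g' wf' :=
      { τ₁ := κ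
        τ₂ := biprod.inl ≫ α ≫ biprod.fst
        τ₃ := biprod.inl ≫ Φ.hom ≫ biprod.fst
        comm₁₂ := by
          have := congrArg (· ≫ biprod.fst) hκ
          simpa using this
        comm₂₃ := by
          have := congrArg (fun t => biprod.inl ≫ t ≫ biprod.fst) hα
          simpa using this }
    exact ShortComplex.ShortExact.extClass_naturality hs hs' φ
  · have : Mono (f ≫ (biprod.inl : P ⟶ P ⊞ E)) := mono_comp _ _
    have : Mono (f' ≫ (biprod.inl : Q ⟶ Q ⊞ O)) := mono_comp _ _
    refine schanuel_core (f ≫ biprod.inl) (biprod.map g (𝟙 E) ≫ Φ.hom)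
      (f' ≫ biprod.inl) (biprod.map g' (𝟙 O)) ?_ lift1' lift2'
      (α - biprod.fst ≫ h ≫ f' ≫ biprod.inl) ?_ β hβ' _ ?_
    · simp [reassoc_of% wf']
    · rw [Preadditive.sub_comp, hα]; simp [reassoc_of% wf']
    · rw [Preadditive.sub_comp, hκ]; simp

/-- Splitting off the last summand of a biproduct indexed by `Fin (n+1)`. -/
lemma biproduct_succ_iso (n : ℕ) (F : ℕ → A) :
    Nonempty ((F n ⊞ ⨁ fun i : Fin n => F i.1) ≅ ⨁ fun i : Fin (n + 1) => F i.1) := by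
  refine ⟨⟨biprod.desc (biproduct.ι (fun i : Fin (n + 1) => F i.1) (Fin.last n))
      (biproduct.desc fun i => biproduct.ι (fun i : Fin (n + 1) => F i.1) i.castSucc),
    biprod.lift (biproduct.π (fun i : Fin (n + 1) => F i.1) (Fin.last n))
      (biproduct.lift fun i => biproduct.π (fun i : Fin (n + 1) => F i.1) i.castSucc), ?_, ?_⟩⟩
  · ext i j
    · simp
    · simp [biproduct.ι_π_ne _ (Fin.castSucc_lt_last _).ne']
    · simp [biproduct.ι_π_ne _ (Fin.castSucc_lt_last _).ne]
    · by_cases hij : i = j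
      · subst hij; simp
      · have : i.castSucc ≠ j.castSucc := fun h => hij (Fin.castSucc_injective _ h)
        simp [biproduct.ι_π_ne _ this, biproduct.ι_π_ne _ hij]
  · apply biproduct.hom_ext'
    intro i
    induction i using Fin.lastCases with
    | last =>
      have : biproduct.ι (fun i : Fin (n + 1) => F i.1) (Fin.last n) ≫
        (biproduct.lift fun i : Fin n =>
          biproduct.π (fun i : Fin (n + 1) => F i.1) i.castSucc) = 0 := by
        ext j
        simp [biproduct.ι_π_ne _ (Fin.castSucc_lt_last _).ne']
      simp [biprod.lift_desc]
      rw [← Category.assoc]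
      erw [this]
      simp
    | cast i =>
      have : biproduct.ι (fun i : Fin (n + 1) => F i.1) i.castSucc ≫
        (biproduct.lift fun i : Fin n =>
          biproduct.π (fun i : Fin (n + 1) => F i.1) i.castSucc) =
            biproduct.ι (fun i : Fin n => F i.1) i := by
        ext j
        by_cases hij : i = j
        · subst hij; simp
        · have : i.castSucc ≠ j.castSucc := fun h => hij (Fin.castSucc_injective _ h)
          simp [biproduct.ι_π_ne _ this, biproduct.ι_π_ne _ hij]
      have h2 := biproduct.ι_π_ne (fun i : Fin (n + 1) => F i.1) (Fin.castSucc_lt_last i).ne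
      simp [biprod.lift_desc, reassoc_of% h2]
      rw [← Category.assoc]
      erw [this]
      simp

/-- The alternating sums `E_i`, `O_i` together with the parity bookkeeping. -/
def altPair (P Q : ℕ → A) (i : ℕ) (E O : A) : Prop :=
  (Even i → Nonempty (E ≅ ⨁ fun j : Fin i => if Even j.1 then P j.1 else Q j.1) ∧
    Nonempty (O ≅ ⨁ fun j : Fin i => if Even j.1 then Q j.1 else P j.1)) ∧
  (¬ Even i → Nonempty (O ≅ ⨁ fun j : Fin i => if Even j.1 then P j.1 else Q j.1) ∧
    Nonempty (E ≅ ⨁ fun j : Fin i => if Even j.1 then Q j.1 else P j.1))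

open ZeroObject in
lemma altPair_zero (P Q : ℕ → A) : ∃ E, Projective E ∧ altPair P Q 0 E E := by
  refine ⟨0, inferInstance, fun _ => ⟨⟨?_⟩, ⟨?_⟩⟩, fun h => absurd Even.zero h⟩
  all_goals
    refine (isZero_zero A).iso ?_
    rw [IsZero.iff_id_eq_zero]
    ext i
    exact i.elim0

lemma altPair_succ (P Q : ℕ → A) (i : ℕ) (E O : A) (h : altPair P Q i E O) :
    altPair P Q (i + 1) (Q i ⊞ O) (P i ⊞ E) := by
  obtain ⟨a⟩ := biproduct_succ_iso i (fun j => if Even j then P j else Q j)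
  obtain ⟨b⟩ := biproduct_succ_iso i (fun j => if Even j then Q j else P j)
  constructor
  · intro hi
    have hi' : ¬ Even i := by rwa [Nat.even_add_one] at hi
    obtain ⟨⟨x⟩, ⟨y⟩⟩ := h.2 hi'
    refine ⟨⟨biprod.mapIso (eqToIso ?_) x ≪≫ a⟩, ⟨biprod.mapIso (eqToIso ?_) y ≪≫ b⟩⟩ <;>
      simp [hi']
  · intro hi
    have hi' : Even i := by rwa [Nat.even_add_one, not_not] at hi
    obtain ⟨⟨x⟩, ⟨y⟩⟩ := h.1 hi'
    refine ⟨⟨biprod.mapIso (eqToIso ?_) x ≪≫ a⟩, ⟨biprod.mapIso (eqToIso ?_) y ≪≫ b⟩⟩ <;>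
      simp [hi']

/-- Dimension shifting along the splice. -/
lemma spliceClass_comp_eq_zero [HasExt.{w} A]
    {N : A} {K P : ℕ → A} (r : ℕ) (hK0 : K 0 = N)
    (f : ∀ i, K (i + 1) ⟶ P i) (g : ∀ i, P i ⟶ K i) (wfg : ∀ i, f i ≫ g i = 0)
    (hse : ∀ i, i ≤ r → (ShortComplex.mk (f i) (g i) (wfg i)).ShortExact)
    (hP : ∀ i, i ≤ r → Projective (P i)) {X : A} :
    ∀ (i : ℕ) (hi : i ≤ r + 1) (n m : ℕ) (hm : i + (n + 1) = m) (y : Ext.{w} (K i) X (n + 1)),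
      (spliceClass r hK0 f g wfg hse i hi).comp y hm = 0 → y = 0 := by
  intro i
  induction i with
  | zero =>
    intro hi n m hm y hy
    subst hK0
    obtain rfl : n + 1 = m := by omega
    simpa [spliceClass] using hy
  | succ i ih =>
    intro hi n m hm y hy
    rw [spliceClass, Ext.comp_assoc (a₂₃ := n + 1 + 1) _ _ _ _ (by omega) (by omega)] at hy
    have h1 := ih (by omega) (n + 1) m (by omega) _ hy
    obtain ⟨x, hx⟩ := Ext.contravariant_sequence_exact₁ (hse i (by omega)) _ y _ h1
    have := hP i (by omega)
    rw [← hx, Ext.eq_zero_of_projective (P := P i) x, Ext.comp_zero]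

/-- The iterated Schanuel isomorphism, compatible with the extension classes. -/
lemma schanuel_iter [HasExt.{w} A]
    {N : A} {K P L Q : ℕ → A} (r : ℕ) (hK0 : K 0 = N) (hL0 : L 0 = N)
    (f : ∀ i, K (i + 1) ⟶ P i) (g : ∀ i, P i ⟶ K i) (wfg : ∀ i, f i ≫ g i = 0)
    (hseP : ∀ i, i ≤ r → (ShortComplex.mk (f i) (g i) (wfg i)).ShortExact)
    (f' : ∀ i, L (i + 1) ⟶ Q i) (g' : ∀ i, Q i ⟶ L i) (wfg' : ∀ i, f' i ≫ g' i = 0)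
    (hseQ : ∀ i, i ≤ r → (ShortComplex.mk (f' i) (g' i) (wfg' i)).ShortExact)
    (hP : ∀ i, i ≤ r → Projective (P i)) (hQ : ∀ i, i ≤ r → Projective (Q i)) :
    ∀ (i : ℕ) (hi : i ≤ r + 1), ∃ E O : A, Projective E ∧ Projective O ∧ altPair P Q i E O ∧
      ∃ Φ : K i ⊞ E ≅ L i ⊞ O,
        (spliceClass r hK0 f g wfg hseP i hi).comp
          (Ext.mk₀ (biprod.inl ≫ Φ.hom ≫ biprod.fst)) (add_zero i) =
        spliceClass r hL0 f' g' wfg' hseQ i hi := by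
  intro i
  induction i with
  | zero =>
    intro hi
    obtain ⟨E, hE, hp⟩ := altPair_zero P Q
    refine ⟨E, E, hE, hE, hp, biprod.mapIso (eqToIso (hK0.trans hL0.symm)) (Iso.refl _), ?_⟩
    simp [spliceClass]
  | succ i ih =>
    intro hi
    obtain ⟨E, O, hE, hO, hp, Φ, hΦ⟩ := ih (by omega)
    have := hP i (by omega)
    have := hQ i (by omega)
    obtain ⟨κ, hκ, H⟩ := schanuel_step (f i) (g i) (wfg i) (hseP i (by omega))
      (f' i) (g' i) (wfg' i) (hseQ i (by omega)) Φ
    obtain ⟨Ψ, hΨ⟩ := H 0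
    refine ⟨Q i ⊞ O, P i ⊞ E, inferInstance, inferInstance, altPair_succ P Q i E O hp, Ψ, ?_⟩
    rw [hΨ, spliceClass, spliceClass, comp_zero, sub_zero, Ext.comp_assoc_of_third_deg_zero, hκ,
      ← hΦ, Ext.comp_assoc_of_second_deg_zero]

end SchanuelHelpers

/-- (Schanuel's lemma for longer exact sequences.)  Let
`0 → M → P_r → ⋯ → P_1 → P_0 → N → 0` and `0 → M → Q_r → ⋯ → Q_1 → Q_0 → N → 0`
be exact sequences in an abelian category (presented as splices of short exact
sequences `0 → K (i+1) → P i → K i → 0`, `K 0 = N`, `K (r+1) = M`, resp.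
`0 → L (i+1) → Q i → L i → 0`) which represent the same class in `Ext^{r+1}(N, M)`.
If all `P i` and `Q i` (for `i ≤ r`) are projective, then
`⊕_{i≥0} (P 2i ⊕ Q (2i+1)) ≅ ⊕_{i≥0} (P (2i+1) ⊕ Q 2i)`, i.e. the direct sum of
the `P i` for even `i ≤ r` and the `Q i` for odd `i ≤ r` is isomorphic to the
direct sum of the `Q i` for even `i ≤ r` and the `P i` for odd `i ≤ r`. -/
theorem schanuel_long_exact_sequences
    {A : Type u} [Category.{v} A] [Abelian A] [HasExt.{w} A]
    {M N : A} {K P L Q : ℕ → A} (r : ℕ)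
    (hK0 : K 0 = N) (hKtop : K (r + 1) = M) (hL0 : L 0 = N) (hLtop : L (r + 1) = M)
    (f : ∀ i, K (i + 1) ⟶ P i) (g : ∀ i, P i ⟶ K i) (wfg : ∀ i, f i ≫ g i = 0)
    (hseP : ∀ i, i ≤ r → (ShortComplex.mk (f i) (g i) (wfg i)).ShortExact)
    (f' : ∀ i, L (i + 1) ⟶ Q i) (g' : ∀ i, Q i ⟶ L i) (wfg' : ∀ i, f' i ≫ g' i = 0)
    (hseQ : ∀ i, i ≤ r → (ShortComplex.mk (f' i) (g' i) (wfg' i)).ShortExact)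
    (hP : ∀ i, i ≤ r → Projective (P i)) (hQ : ∀ i, i ≤ r → Projective (Q i))
    (hclass :
      (spliceClass r hK0 f g wfg hseP (r + 1) le_rfl).comp (Ext.mk₀ (eqToHom hKtop)) rfl =
      (spliceClass r hL0 f' g' wfg' hseQ (r + 1) le_rfl).comp (Ext.mk₀ (eqToHom hLtop)) rfl) :
    Nonempty
      ((⨁ fun i : Fin (r + 1) => if Even i.1 then P i.1 else Q i.1) ≅
        ⨁ fun i : Fin (r + 1) => if Even i.1 then Q i.1 else P i.1) := by
  obtain ⟨E, O, hE, hO, hp, Φ, hΦ⟩ := schanuel_iter r hK0 hL0 f g wfg hseP f' g' wfg' hseQ hP hQ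
    r (by omega)
  have := hP r le_rfl
  have := hQ r le_rfl
  obtain ⟨κ, hκ, H⟩ := schanuel_step (f r) (g r) (wfg r) (hseP r le_rfl)
    (f' r) (g' r) (wfg' r) (hseQ r le_rfl) Φ
  have hκ' : (spliceClass r hK0 f g wfg hseP (r + 1) le_rfl).comp (Ext.mk₀ κ) (add_zero _) =
      spliceClass r hL0 f' g' wfg' hseQ (r + 1) le_rfl := by
    rw [spliceClass, spliceClass, Ext.comp_assoc_of_third_deg_zero, hκ,
      ← hΦ, Ext.comp_assoc_of_second_deg_zero]
  let ψ : K (r + 1) ⟶ L (r + 1) := eqToHom (hKtop.trans hLtop.symm)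
  have hψ : (spliceClass r hK0 f g wfg hseP (r + 1) le_rfl).comp (Ext.mk₀ ψ) (add_zero _) =
      spliceClass r hL0 f' g' wfg' hseQ (r + 1) le_rfl := by
    have := congrArg (fun t => t.comp (Ext.mk₀ (eqToHom hLtop.symm)) (add_zero _)) hclass
    simpa [Ext.comp_assoc_of_third_deg_zero] using this
  have h0 : (spliceClass r hK0 f g wfg hseP (r + 1) le_rfl).comp (Ext.mk₀ (κ - ψ))
      (add_zero _) = 0 := by
    rw [sub_eq_add_neg, Ext.mk₀_add, Ext.mk₀_neg, Ext.comp_add, Ext.comp_neg, hκ', hψ,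
      add_neg_cancel]
  rw [spliceClass, Ext.comp_assoc_of_third_deg_zero] at h0
  have h1 := spliceClass_comp_eq_zero r hK0 f g wfg hseP hP r (by omega) 0 _ _ _ h0
  obtain ⟨x, hx⟩ := Ext.contravariant_sequence_exact₁ (hseP r le_rfl) _ _ _ h1
  obtain ⟨h, rfl⟩ := (Ext.mk₀_bijective _ _).2 x
  have hh : f r ≫ h = κ - ψ := by
    apply (Ext.mk₀_bijective _ _).1
    simpa using hx
  obtain ⟨Ψ, hΨ⟩ := H h
  rw [hh, sub_sub_cancel] at hΨ
  have : IsIso (biprod.inl ≫ Ψ.hom ≫ biprod.fst) := by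
    rw [hΨ]; infer_instance
  have e := Biprod.isoElim Ψ
  have hp' := altPair_succ P Q r E O hp
  by_cases hr : Even (r + 1)
  · obtain ⟨⟨x⟩, ⟨y⟩⟩ := hp'.1 hr
    exact ⟨x.symm ≪≫ e ≪≫ y⟩
  · obtain ⟨⟨x⟩, ⟨y⟩⟩ := hp'.2 hr
    exact ⟨x.symm ≪≫ e.symm ≪≫ y⟩
end

section
/- Let A be an essentially small abelian category. The space Sp A of irreducible additive functions Ob A → ℕ with the Ziegler topology satisfies the T1 separation axiom: every singleton {χ} is closed. -/
open CategoryTheory CategoryTheory.Limits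

universe v u

/-- A function on the objects of an abelian category is *additive* if it is
additive on short exact sequences. -/
def IsAdditiveFn {A : Type u} [Category.{v} A] [Abelian A] (χ : A → ℕ) : Prop :=
  ∀ S : ShortComplex A, S.ShortExact → χ S.X₂ = χ S.X₁ + χ S.X₃

/-- An additive function is *irreducible* if it is nonzero and cannot be written
as the (pointwise) sum of two nonzero additive functions. -/
def IsIrreducibleAdd {A : Type u} [Category.{v} A] [Abelian A] (χ : A → ℕ) : Prop :=
  (∃ X : A, χ X ≠ 0) ∧
    ∀ φ ψ : A → ℕ, IsAdditiveFn φ → IsAdditiveFn ψ → (∀ X : A, χ X = φ X + ψ X) →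
      (∀ X : A, φ X = 0) ∨ (∀ X : A, ψ X = 0)

/-- The space `Sp A` of irreducible additive functions on `A`. -/
def SpFn (A : Type u) [Category.{v} A] [Abelian A] :=
  {χ : A → ℕ // IsAdditiveFn χ ∧ IsIrreducibleAdd χ}

/-- The Ziegler topology on `Sp A`, generated by the basic open sets
`(Y) = {χ | χ Y ≠ 0}` for `Y` an object of `A`. -/
instance SpFn.topologicalSpace (A : Type u) [Category.{v} A] [Abelian A] :
    TopologicalSpace (SpFn A) :=
  TopologicalSpace.generateFrom {U | ∃ Y : A, U = {χ : SpFn A | χ.1 Y ≠ 0}}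

section Aux

open ZeroObject

variable {A : Type u} [Category.{v} A] [Abelian A]

lemma aux_iso_shortExact {Z Z' : A} (e : Z ≅ Z') :
    (ShortComplex.mk e.hom (0 : Z' ⟶ (0 : A)) (by simp)).ShortExact where
  exact := by
    rw [ShortComplex.exact_iff_epi _ rfl]
    dsimp
    infer_instance
  mono_f := by dsimp; infer_instance
  epi_g := by
    dsimp
    exact ⟨fun _ _ _ => (isZero_zero A).eq_of_src _ _⟩

lemma IsAdditiveFn.zero {χ : A → ℕ} (h : IsAdditiveFn χ) : χ 0 = 0 := by
  have := h _ (aux_iso_shortExact (Iso.refl (0 : A)))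
  dsimp at this
  omega

lemma aux_image_left {B B' : A} (h : B ⟶ B') :
    (ShortComplex.mk (kernel.ι h) (Abelian.factorThruImage h) (by
      rw [← cancel_mono (Abelian.image.ι h)]; simp)).ShortExact where
  exact := by
    apply ShortComplex.exact_of_f_is_kernel
    refine KernelFork.IsLimit.ofι _ _
      (fun g hg => kernel.lift h g (by
        rw [← Abelian.image.fac h, ← Category.assoc, hg, zero_comp]))
      (fun g hg => by simp)
      (fun g hg m hm => by rw [← cancel_mono (kernel.ι h)]; simpa using hm)
  mono_f := by dsimp; infer_instance
  epi_g := by dsimp; infer_instance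

lemma aux_image_right {B B' : A} (h : B ⟶ B') :
    (ShortComplex.mk (Abelian.image.ι h) (cokernel.π h) (by simp)).ShortExact where
  exact := ShortComplex.exact_of_f_is_kernel _ (kernelIsKernel _)
  mono_f := by dsimp; infer_instance
  epi_g := by dsimp; infer_instance

/-- Costs of finite filtrations. -/
inductive AuxCost (m : A → ℕ) : A → ℕ → Prop
  | base (Z : A) : AuxCost m Z (m Z)
  | ext (S : ShortComplex A) (hS : S.ShortExact) (a b : ℕ) (ha : AuxCost m S.X₁ a)
      (hb : AuxCost m S.X₃ b) : AuxCost m S.X₂ (a + b)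

lemma AuxCost.iso {m : A → ℕ} (hm : m 0 = 0) {Z Z' : A} (e : Z ≅ Z') {n : ℕ}
    (h : AuxCost m Z n) : AuxCost m Z' n := by
  have h0 : AuxCost m (0 : A) 0 := by
    have := AuxCost.base (m := m) (0 : A)
    rwa [hm] at this
  exact AuxCost.ext _ (aux_iso_shortExact e) n 0 h h0

lemma aux_kernel_iso {S T : ShortComplex A} (hS : S.ShortExact) (hT : T.ShortExact)
    (e : S.X₂ = T.X₂) :
    Nonempty (kernel (S.f ≫ eqToHom e ≫ T.g) ≅ kernel (T.f ≫ eqToHom e.symm ≫ S.g)) ∧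
    Nonempty (cokernel (S.f ≫ eqToHom e ≫ T.g) ≅ cokernel (T.f ≫ eqToHom e.symm ≫ S.g)) := by
  obtain @⟨X, Z, Y, i, p, hip⟩ := S
  obtain @⟨U, Z', V, j, q, hjq⟩ := T
  dsimp at e
  subst e
  have := hS.mono_f
  have := hT.mono_f
  have := hS.epi_g
  have := hT.epi_g
  dsimp at *
  simp only [Category.id_comp]
  constructor
  · let a := hT.exact.lift (kernel.ι (i ≫ q) ≫ i) (by simp)
    have ha : a ≫ j = kernel.ι (i ≫ q) ≫ i := hT.exact.lift_f _ _
    let b := hS.exact.lift (kernel.ι (j ≫ p) ≫ j) (by simp)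
    have hb : b ≫ i = kernel.ι (j ≫ p) ≫ j := hS.exact.lift_f _ _
    refine ⟨⟨kernel.lift _ a (by rw [reassoc_of% ha, hip, comp_zero]),
      kernel.lift _ b (by rw [reassoc_of% hb, hjq, comp_zero]), ?_, ?_⟩⟩
    · rw [← cancel_mono (kernel.ι _), ← cancel_mono i]
      simp [ha, hb]
    · rw [← cancel_mono (kernel.ι _), ← cancel_mono j]
      simp [ha, hb]
  · let a := hT.exact.desc (p ≫ cokernel.π (j ≫ p)) (by
      dsimp; rw [← Category.assoc, cokernel.condition])
    have ha : q ≫ a = p ≫ cokernel.π (j ≫ p) := hT.exact.g_desc _ _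
    let b := hS.exact.desc (q ≫ cokernel.π (i ≫ q)) (by
      dsimp; rw [← Category.assoc, cokernel.condition])
    have hb : p ≫ b = q ≫ cokernel.π (i ≫ q) := hS.exact.g_desc _ _
    refine ⟨⟨cokernel.desc _ a (by rw [Category.assoc, ha, reassoc_of% hip, zero_comp]),
      cokernel.desc _ b (by rw [Category.assoc, hb, reassoc_of% hjq, zero_comp]), ?_, ?_⟩⟩
    · rw [← cancel_epi (cokernel.π _), ← cancel_epi q]
      simp [reassoc_of% ha, hb]
    · rw [← cancel_epi (cokernel.π _), ← cancel_epi p]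
      simp [reassoc_of% hb, ha]

lemma AuxCost.super {m : A → ℕ} (hm : m 0 = 0)
    (hsup : ∀ S : ShortComplex A, S.ShortExact → m S.X₁ + m S.X₃ ≤ m S.X₂) {Z : A} {n : ℕ}
    (h : AuxCost m Z n) : ∀ S : ShortComplex A, S.ShortExact → S.X₂ = Z →
      ∃ a b, AuxCost m S.X₁ a ∧ AuxCost m S.X₃ b ∧ a + b ≤ n := by
  induction h with
  | base Z =>
    rintro S hS rfl
    exact ⟨_, _, .base _, .base _, hsup S hS⟩
  | ext T hT a b ha hb iha ihb =>
    intro S hS e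
    obtain ⟨⟨e₁⟩, ⟨e₂⟩⟩ := aux_kernel_iso hS hT e
    obtain ⟨w, j, hw, hj, hwj⟩ := iha _ (aux_image_left (T.f ≫ eqToHom e.symm ≫ S.g)) rfl
    obtain ⟨i, c, hi, hc, hic⟩ := ihb _ (aux_image_right (S.f ≫ eqToHom e ≫ T.g)) rfl
    refine ⟨w + i, j + c, .ext _ (aux_image_left (S.f ≫ eqToHom e ≫ T.g)) _ _
      (AuxCost.iso hm e₁.symm hw) hi, .ext _ (aux_image_right (T.f ≫ eqToHom e.symm ≫ S.g)) _ _
      hj (AuxCost.iso hm e₂ hc), by omega⟩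

/-- Minimal cost of a filtration. -/
noncomputable def auxInf (m : A → ℕ) (Z : A) : ℕ := sInf {n | AuxCost m Z n}

lemma auxInf_mem (m : A → ℕ) (Z : A) : AuxCost m Z (auxInf m Z) :=
  Nat.sInf_mem (s := {n | AuxCost m Z n}) ⟨_, .base Z⟩

lemma auxInf_le {m : A → ℕ} {Z : A} {n : ℕ} (h : AuxCost m Z n) : auxInf m Z ≤ n :=
  Nat.sInf_le h

lemma auxInf_additive {m : A → ℕ} (hm : m 0 = 0)
    (hsup : ∀ S : ShortComplex A, S.ShortExact → m S.X₁ + m S.X₃ ≤ m S.X₂) :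
    IsAdditiveFn (auxInf m) := by
  intro S hS
  apply le_antisymm
  · exact auxInf_le (.ext S hS _ _ (auxInf_mem _ _) (auxInf_mem _ _))
  · obtain ⟨a, b, ha, hb, hab⟩ := (auxInf_mem m S.X₂).super hm hsup S hS rfl
    have := auxInf_le ha
    have := auxInf_le hb
    omega

lemma aux_irred_eq {χ φ : A → ℕ} (hχ : IsAdditiveFn χ) (hi : IsIrreducibleAdd χ)
    (hφ : IsAdditiveFn φ) (hle : ∀ X, φ X ≤ χ X) (h0 : ¬ ∀ X, φ X = 0) : φ = χ := by
  rcases hi.2 φ (fun X => χ X - φ X) hφ (by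
    intro S hS
    have := hχ S hS
    have := hφ S hS
    have := hle S.X₁
    have := hle S.X₃
    dsimp only
    omega) (fun X => by have := hle X; omega) with h | h
  · exact absurd h h0
  · funext X
    have := h X
    have := hle X
    omega

lemma aux_cost_zero {χ χ' : A → ℕ} (hχ' : IsAdditiveFn χ') (h : ∀ X, χ X = 0 → χ' X = 0)
    {Z : A} {n : ℕ} (hc : AuxCost (fun X => min (χ X) (χ' X)) Z n) (hn : n = 0) : χ' Z = 0 := by
  induction hc with
  | base Z =>
    have := h Z
    omega
  | ext S hS a b _ _ iha ihb =>
    have := hχ' S hS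
    have := iha (by omega)
    have := ihb (by omega)
    omega

lemma aux_eq {χ χ' : A → ℕ} (hχ : IsAdditiveFn χ) (hi : IsIrreducibleAdd χ)
    (hχ' : IsAdditiveFn χ') (hi' : IsIrreducibleAdd χ') (h : ∀ X, χ X = 0 → χ' X = 0) :
    χ' = χ := by
  let m : A → ℕ := fun X => min (χ X) (χ' X)
  have hadd : IsAdditiveFn (auxInf m) := by
    apply auxInf_additive
    · simp [m, hχ.zero]
    · intro S hS
      have := hχ S hS
      have := hχ' S hS
      dsimp only [m]
      omega
  have h0 : ¬ ∀ X, auxInf m X = 0 := by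
    intro h0
    obtain ⟨X, hX⟩ := hi'.1
    exact hX (aux_cost_zero hχ' h (auxInf_mem m X) (h0 X))
  have hle : ∀ X, auxInf m X ≤ m X := fun X => auxInf_le (.base X)
  rw [← aux_irred_eq hχ hi hadd (fun X => (hle X).trans (min_le_left _ _)) h0]
  exact (aux_irred_eq hχ' hi' hadd (fun X => (hle X).trans (min_le_right _ _)) h0).symm

end Aux

/-- STATEMENT 17: The space `Sp A` of irreducible additive functions with the
Ziegler topology satisfies the T1 separation axiom. -/
theorem spFn_t1Space (A : Type u) [Category.{v} A] [EssentiallySmall.{v} A] [Abelian A] :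
    T1Space (SpFn A) := by
  refine ⟨fun χ => ?_⟩
  rw [← isOpen_compl_iff]
  have : ({χ}ᶜ : Set (SpFn A)) =
      ⋃ Y ∈ {Y : A | χ.1 Y = 0}, {χ' : SpFn A | χ'.1 Y ≠ 0} := by
    ext χ'
    simp only [Set.mem_compl_iff, Set.mem_singleton_iff, Set.mem_iUnion, Set.mem_ofPred_eq]
    constructor
    · intro hne
      by_contra hcon
      push Not at hcon
      exact hne (Subtype.ext (aux_eq χ.2.1 χ.2.2 χ'.2.1 χ'.2.2 hcon))
    · rintro ⟨Y, h1, h2⟩ rfl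
      exact h2 h1
  rw [this]
  exact isOpen_biUnion fun Y _ => TopologicalSpace.isOpen_generateFrom_of_mem ⟨Y, rfl⟩
end
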